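/- For all θ₁, θ₂ ∈ [0, 2π) one has g(θ₁, θ₂) ≥ −3/2, with equality if and only if (θ₁, θ₂) = (2π/3, 4π/3) or (θ₁, θ₂) = (4π/3, 2π/3). -/

import Mathlib

open Real

/-- `g(θ₁,θ₂) = cos θ₁ + cos (θ₂ - θ₁) + cos θ₂`. -/
noncomputable def g (θ₁ θ₂ : ℝ) : ℝ := Real.cos θ₁ + Real.cos (θ₂ - θ₁) + Real.cos θ₂

theorem cos_two_mul_pi_div_three : Real.cos (2 * π / 3) = -(1 / 2) := by
  rw [show 2 * π / 3 = π - π / 3 by ring, Real.cos_pi_sub, Real.cos_pi_div_three]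

theorem cos_four_mul_pi_div_three : Real.cos (4 * π / 3) = -(1 / 2) := by
  rw [show 4 * π / 3 = π / 3 + π by ring, Real.cos_add_pi, Real.cos_pi_div_three]

theorem eq_or_eq_of_cos_eq_neg_half {x : ℝ} (hx : x ∈ Set.Ico 0 (2 * π))
    (h : Real.cos x = -(1 / 2)) : x = 2 * π / 3 ∨ x = 4 * π / 3 := by
  obtain ⟨h0, h2⟩ := hx
  have hpi := Real.pi_pos
  have hmem : 2 * π / 3 ∈ Set.Icc 0 π := ⟨by linarith, by linarith⟩
  rcases le_total x π with hle | hle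
  · exact Or.inl (Real.injOn_cos ⟨h0, hle⟩ hmem (h.trans cos_two_mul_pi_div_three.symm))
  · have hc : Real.cos (2 * π - x) = Real.cos (2 * π / 3) := by
      rw [Real.cos_two_pi_sub, h, cos_two_mul_pi_div_three]
    have := Real.injOn_cos ⟨by linarith, by linarith⟩ hmem hc
    exact Or.inr (by linarith)

theorem three_add_two_mul_g (x y : ℝ) :
    3 + 2 * g x y =
      (1 + Real.cos x + Real.cos y) ^ 2 + (Real.sin x + Real.sin y) ^ 2 := by
  rw [g, Real.cos_sub]
  linear_combination -Real.sin_sq_add_cos_sq x - Real.sin_sq_add_cos_sq y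

/-- For all `θ₁, θ₂ ∈ [0, 2π)` one has `g(θ₁,θ₂) ≥ -3/2`, with equality if and only if
`(θ₁,θ₂) = (2π/3, 4π/3)` or `(θ₁,θ₂) = (4π/3, 2π/3)`. -/
theorem stmt_4 (θ₁ θ₂ : ℝ) (h₁ : θ₁ ∈ Set.Ico 0 (2 * π)) (h₂ : θ₂ ∈ Set.Ico 0 (2 * π)) :
    -(3 / 2) ≤ g θ₁ θ₂ ∧
    (g θ₁ θ₂ = -(3 / 2) ↔
      (θ₁ = 2 * π / 3 ∧ θ₂ = 4 * π / 3) ∨ (θ₁ = 4 * π / 3 ∧ θ₂ = 2 * π / 3)) := by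
  have key := three_add_two_mul_g θ₁ θ₂
  have hc := sq_nonneg (1 + Real.cos θ₁ + Real.cos θ₂)
  have hs := sq_nonneg (Real.sin θ₁ + Real.sin θ₂)
  refine ⟨by linarith, fun h => ?_, ?_⟩
  · have hc0 : 1 + Real.cos θ₁ + Real.cos θ₂ = 0 := pow_eq_zero_iff two_ne_zero |>.mp (by linarith)
    have hs0 : Real.sin θ₁ + Real.sin θ₂ = 0 := pow_eq_zero_iff two_ne_zero |>.mp (by linarith)
    have e₁ := Real.sin_sq_add_cos_sq θ₁
    have e₂ := Real.sin_sq_add_cos_sq θ₂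
    have hc₁ : Real.cos θ₁ = -(1 / 2) := by
      linear_combination ((1 + Real.cos θ₁ - Real.cos θ₂) * hc0
        + (Real.sin θ₁ - Real.sin θ₂) * hs0 - e₁ + e₂) / 2
    have hc₂ : Real.cos θ₂ = -(1 / 2) := by linarith
    have hne : θ₁ ≠ θ₂ := by
      rintro rfl
      have hs₁ : Real.sin θ₁ = 0 := by linarith
      rw [hs₁, hc₁] at e₁
      norm_num at e₁
    rcases eq_or_eq_of_cos_eq_neg_half h₁ hc₁ with a | a <;>
      rcases eq_or_eq_of_cos_eq_neg_half h₂ hc₂ with b | b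
    · exact absurd (a.trans b.symm) hne
    · exact Or.inl ⟨a, b⟩
    · exact Or.inr ⟨a, b⟩
    · exact absurd (a.trans b.symm) hne
  · rintro (⟨rfl, rfl⟩ | ⟨rfl, rfl⟩)
    · rw [g, show 4 * π / 3 - 2 * π / 3 = 2 * π / 3 by ring, cos_two_mul_pi_div_three,
        cos_four_mul_pi_div_three]
      norm_num
    · rw [g, show 2 * π / 3 - 4 * π / 3 = -(2 * π / 3) by ring, Real.cos_neg,
        cos_two_mul_pi_div_three, cos_four_mul_pi_div_three]
      norm_num
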